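/- Assume there exists α_0 ∈ (0,1) such that α_0 > t_1 and 1 − α_0 > t_2 for all (t_1,t_2) ∈ T (disagreement is commonly known to be strictly Pareto dominated by a lottery over a_1 and a_2). Then there exists a constant mechanism μ (μ(t) independent of t, hence incentive compatible) that is individually rational and efficient (μ^0 = 0 and its utility pair lies in ∂V), and which moreover is ex-ante incentive efficient: no mechanism ν (with μ^k ≥ 0 summing to 1) satisfies Σ_{t_i} f_i(t_i) U_i^ν(t_i) ≥ Σ_{t_i} f_i(t_i) U_i^μ(t_i) for both i with strict inequality for some i. -/

import Mathlib

open Finset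

noncomputable section

/-- Ex-post expected utility of player 1 when `that` is the reported type pair and `t` is the
true type pair.  Index `0` of the mechanism is the disagreement outcome `a₀` (at which player 1
of type `t₁` gets utility `t₁`), and index `k.succ` is the alternative `aₖ`. -/
def u1post {n : ℕ} (u₁ : Fin n → ℝ) (μ : ℝ × ℝ → Fin (n + 1) → ℝ) (that t : ℝ × ℝ) : ℝ :=
  (∑ k : Fin n, μ that k.succ * u₁ k) + μ that 0 * t.1

/-- Ex-post expected utility of player 2. -/
def u2post {n : ℕ} (u₂ : Fin n → ℝ) (μ : ℝ × ℝ → Fin (n + 1) → ℝ) (that t : ℝ × ℝ) : ℝ :=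
  (∑ k : Fin n, μ that k.succ * u₂ k) + μ that 0 * t.2

/-- Marginal of the prior for player 1: `f₁(t₁) = ∑_{t₂ ∈ T₂} f(t₁,t₂)`. -/
def marg1 (T₂ : Finset ℝ) (f : ℝ × ℝ → ℝ) (t₁ : ℝ) : ℝ := ∑ t₂ ∈ T₂, f (t₁, t₂)

/-- Marginal of the prior for player 2: `f₂(t₂) = ∑_{t₁ ∈ T₁} f(t₁,t₂)`. -/
def marg2 (T₁ : Finset ℝ) (f : ℝ × ℝ → ℝ) (t₂ : ℝ) : ℝ := ∑ t₁ ∈ T₁, f (t₁, t₂)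

/-- Interim expected utility of player 1 of true type `t₁` reporting `r₁`, when player 2 reports
truthfully:  `U₁^μ(r₁|t₁) = ∑_{t₂} f₁^c(t₂|t₁) u₁^μ((r₁,t₂);(t₁,t₂))`. -/
def interim1 (T₂ : Finset ℝ) (f : ℝ × ℝ → ℝ) {n : ℕ} (u₁ : Fin n → ℝ)
    (μ : ℝ × ℝ → Fin (n + 1) → ℝ) (r₁ t₁ : ℝ) : ℝ :=
  ∑ t₂ ∈ T₂, f (t₁, t₂) / marg1 T₂ f t₁ * u1post u₁ μ (r₁, t₂) (t₁, t₂)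

/-- Interim expected utility of player 2 of true type `t₂` reporting `r₂`. -/
def interim2 (T₁ : Finset ℝ) (f : ℝ × ℝ → ℝ) {n : ℕ} (u₂ : Fin n → ℝ)
    (μ : ℝ × ℝ → Fin (n + 1) → ℝ) (r₂ t₂ : ℝ) : ℝ :=
  ∑ t₁ ∈ T₁, f (t₁, t₂) / marg2 T₁ f t₂ * u2post u₂ μ (t₁, r₂) (t₁, t₂)

/-- `f` is a (common prior) probability distribution on `T₁ × T₂` with positive marginals. -/
def IsPrior (T₁ T₂ : Finset ℝ) (f : ℝ × ℝ → ℝ) : Prop :=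
  (∀ t₁ ∈ T₁, ∀ t₂ ∈ T₂, 0 ≤ f (t₁, t₂)) ∧
  (∑ t₁ ∈ T₁, ∑ t₂ ∈ T₂, f (t₁, t₂)) = 1 ∧
  (∀ t₁ ∈ T₁, 0 < marg1 T₂ f t₁) ∧ (∀ t₂ ∈ T₂, 0 < marg2 T₁ f t₂)

/-- Physical feasibility: `μ t` is a probability vector over the `n + 1` alternatives. -/
def Feasible (T₁ T₂ : Finset ℝ) {n : ℕ} (μ : ℝ × ℝ → Fin (n + 1) → ℝ) : Prop :=
  ∀ t₁ ∈ T₁, ∀ t₂ ∈ T₂, (∀ k, 0 ≤ μ (t₁, t₂) k) ∧ (∑ k, μ (t₁, t₂) k) = 1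

/-- Incentive compatibility: truthful reporting is a Bayesian Nash equilibrium. -/
def IC (T₁ T₂ : Finset ℝ) (f : ℝ × ℝ → ℝ) {n : ℕ} (u₁ u₂ : Fin n → ℝ)
    (μ : ℝ × ℝ → Fin (n + 1) → ℝ) : Prop :=
  (∀ t₁ ∈ T₁, ∀ r₁ ∈ T₁, interim1 T₂ f u₁ μ r₁ t₁ ≤ interim1 T₂ f u₁ μ t₁ t₁) ∧
  (∀ t₂ ∈ T₂, ∀ r₂ ∈ T₂, interim2 T₁ f u₂ μ r₂ t₂ ≤ interim2 T₁ f u₂ μ t₂ t₂)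

/-- Individual rationality: each type gets at least its disagreement value at the interim stage. -/
def IR (T₁ T₂ : Finset ℝ) (f : ℝ × ℝ → ℝ) {n : ℕ} (u₁ u₂ : Fin n → ℝ)
    (μ : ℝ × ℝ → Fin (n + 1) → ℝ) : Prop :=
  (∀ t₁ ∈ T₁, t₁ ≤ interim1 T₂ f u₁ μ t₁ t₁) ∧
  (∀ t₂ ∈ T₂, t₂ ≤ interim2 T₁ f u₂ μ t₂ t₂)

/-- Ordinality: each player's interim utility map is constant on his type set. -/
def OrdinalMech (T₁ T₂ : Finset ℝ) (f : ℝ × ℝ → ℝ) {n : ℕ} (u₁ u₂ : Fin n → ℝ)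
    (μ : ℝ × ℝ → Fin (n + 1) → ℝ) : Prop :=
  ∃ v₁ v₂ : ℝ, (∀ t₁ ∈ T₁, interim1 T₂ f u₁ μ t₁ t₁ = v₁) ∧
    (∀ t₂ ∈ T₂, interim2 T₁ f u₂ μ t₂ t₂ = v₂)

/-- The set `V` of feasible agreement utility pairs: expected utilities of lotteries over
`a₁, …, aₙ`. -/
def Vset {n : ℕ} (u₁ u₂ : Fin n → ℝ) : Set (ℝ × ℝ) :=
  {v | ∃ ℓ : Fin n → ℝ, (∀ k, 0 ≤ ℓ k) ∧ (∑ k, ℓ k) = 1 ∧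
    v = (∑ k, ℓ k * u₁ k, ∑ k, ℓ k * u₂ k)}

/-- The Pareto frontier `∂V` of `Vset`. -/
def paretoV {n : ℕ} (u₁ u₂ : Fin n → ℝ) : Set (ℝ × ℝ) :=
  {v ∈ Vset u₁ u₂ | ¬ ∃ v' ∈ Vset u₁ u₂, v.1 ≤ v'.1 ∧ v.2 ≤ v'.2 ∧ v' ≠ v}

/-- `Vset u₁ u₂` is the linear image of the standard simplex. -/
theorem Vset_eq_image {n : ℕ} (u₁ u₂ : Fin n → ℝ) :
    Vset u₁ u₂ =
      Fintype.linearCombination ℝ (fun k => (u₁ k, u₂ k)) '' stdSimplex ℝ (Fin n) := by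
  have key : ∀ ℓ : Fin n → ℝ, Fintype.linearCombination ℝ (fun k => (u₁ k, u₂ k)) ℓ =
      (∑ k, ℓ k * u₁ k, ∑ k, ℓ k * u₂ k) := fun ℓ => by
    ext <;> simp [Fintype.linearCombination_apply, Prod.fst_sum, Prod.snd_sum]
  ext v
  constructor
  · rintro ⟨ℓ, h₀, h₁, rfl⟩
    exact ⟨ℓ, ⟨h₀, h₁⟩, key ℓ⟩
  · rintro ⟨ℓ, ⟨h₀, h₁⟩, rfl⟩
    exact ⟨ℓ, h₀, h₁, key ℓ⟩

theorem convex_Vset {n : ℕ} (u₁ u₂ : Fin n → ℝ) : Convex ℝ (Vset u₁ u₂) := by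
  rw [Vset_eq_image]
  exact (convex_stdSimplex ℝ (Fin n)).linear_image _

theorem isCompact_Vset {n : ℕ} (u₁ u₂ : Fin n → ℝ) : IsCompact (Vset u₁ u₂) := by
  rw [Vset_eq_image]
  exact (isCompact_stdSimplex ℝ (Fin n)).image (LinearMap.continuous_of_finiteDimensional _)

/-- Every point of `Vset` is weakly dominated by a point of the Pareto frontier. -/
theorem exists_mem_paretoV_ge {n : ℕ} {u₁ u₂ : Fin n → ℝ} {w : ℝ × ℝ} (hw : w ∈ Vset u₁ u₂) :
    ∃ v ∈ paretoV u₁ u₂, w.1 ≤ v.1 ∧ w.2 ≤ v.2 := by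
  obtain ⟨v, ⟨hvV, hwv⟩, hmax⟩ :=
    ((isCompact_Vset u₁ u₂).inter_right (isClosed_Ici (a := w))).exists_isMaxOn
      ⟨w, hw, le_refl w⟩ (f := fun v => v.1 + v.2) (by fun_prop)
  refine ⟨v, ⟨hvV, ?_⟩, hwv.1, hwv.2⟩
  rintro ⟨v', hv'V, h₁, h₂, hne⟩
  have hle : v'.1 + v'.2 ≤ v.1 + v.2 :=
    hmax ⟨hv'V, ⟨hwv.1.trans h₁, hwv.2.trans h₂⟩⟩
  exact hne (Prod.ext (by linarith) (by linarith))

/-- Replacing disagreement by an agreement lottery gives a point of `Vset`. -/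
theorem add_disagreement_smul_mem_Vset {n : ℕ} {u₁ u₂ : Fin n → ℝ} {w : ℝ × ℝ}
    (hw : w ∈ Vset u₁ u₂) {p : Fin (n + 1) → ℝ} (hp : ∀ k, 0 ≤ p k) (hp₁ : ∑ k, p k = 1) :
    ((∑ k : Fin n, p k.succ * u₁ k) + p 0 * w.1, (∑ k : Fin n, p k.succ * u₂ k) + p 0 * w.2) ∈
      Vset u₁ u₂ := by
  obtain ⟨ℓ, h₀, h₁, rfl⟩ := hw
  refine ⟨fun k => p k.succ + p 0 * ℓ k,
    fun k => add_nonneg (hp _) (mul_nonneg (hp _) (h₀ k)), ?_, ?_⟩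
  · rw [Fin.sum_univ_succ] at hp₁
    rw [sum_add_distrib, ← mul_sum, h₁, mul_one, add_comm, hp₁]
  · simp only [add_mul, sum_add_distrib, mul_sum, mul_assoc]

theorem lottery_mem_Vset {n : ℕ} {u₁ u₂ : Fin n → ℝ} {i j : Fin n}
    (hi₁ : u₁ i = 1) (hi₂ : u₂ i = 0) (hj₁ : u₁ j = 0) (hj₂ : u₂ j = 1)
    {α : ℝ} (h₀ : 0 ≤ α) (h₁ : α ≤ 1) : (α, 1 - α) ∈ Vset u₁ u₂ := by
  have vertex : ∀ k, (u₁ k, u₂ k) ∈ Vset u₁ u₂ := fun k =>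
    ⟨Pi.single k 1, (single_mem_stdSimplex ℝ k).1, (single_mem_stdSimplex ℝ k).2, by
      simp [Pi.single_apply]⟩
  simpa [hi₁, hi₂, hj₁, hj₂] using
    convex_Vset u₁ u₂ (vertex i) (vertex j) h₀ (sub_nonneg.2 h₁) (add_sub_cancel α 1)

theorem sum_marg1_mul_interim1 {T₁ T₂ : Finset ℝ} {f : ℝ × ℝ → ℝ}
    (hf : ∀ t₁ ∈ T₁, 0 < marg1 T₂ f t₁) {n : ℕ} (u₁ : Fin n → ℝ)
    (μ : ℝ × ℝ → Fin (n + 1) → ℝ) :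
    ∑ t₁ ∈ T₁, marg1 T₂ f t₁ * interim1 T₂ f u₁ μ t₁ t₁ =
      ∑ t ∈ T₁ ×ˢ T₂, f t * u1post u₁ μ t t := by
  rw [sum_product]
  refine sum_congr rfl fun t₁ h₁ => ?_
  rw [interim1, mul_sum]
  refine sum_congr rfl fun t₂ _ => ?_
  rw [← mul_assoc, mul_div_cancel₀ _ (hf t₁ h₁).ne']

theorem sum_marg2_mul_interim2 {T₁ T₂ : Finset ℝ} {f : ℝ × ℝ → ℝ}
    (hf : ∀ t₂ ∈ T₂, 0 < marg2 T₁ f t₂) {n : ℕ} (u₂ : Fin n → ℝ)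
    (μ : ℝ × ℝ → Fin (n + 1) → ℝ) :
    ∑ t₂ ∈ T₂, marg2 T₁ f t₂ * interim2 T₁ f u₂ μ t₂ t₂ =
      ∑ t ∈ T₁ ×ˢ T₂, f t * u2post u₂ μ t t := by
  rw [sum_product_right]
  refine sum_congr rfl fun t₂ h₂ => ?_
  rw [interim2, mul_sum]
  refine sum_congr rfl fun t₁ _ => ?_
  rw [← mul_assoc, mul_div_cancel₀ _ (hf t₂ h₂).ne']

/-- If a lottery `w` dominates disagreement at all types, then the ex-ante utilities of any
feasible mechanism are weakly dominated by a point of `Vset`. -/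
theorem exists_mem_Vset_exAnte_le {T₁ T₂ : Finset ℝ} {f : ℝ × ℝ → ℝ} (hf : IsPrior T₁ T₂ f)
    {n : ℕ} {u₁ u₂ : Fin n → ℝ} {w : ℝ × ℝ} (hw : w ∈ Vset u₁ u₂)
    (hle : ∀ t₁ ∈ T₁, ∀ t₂ ∈ T₂, t₁ ≤ w.1 ∧ t₂ ≤ w.2)
    {ν : ℝ × ℝ → Fin (n + 1) → ℝ} (hν : Feasible T₁ T₂ ν) :
    ∃ v ∈ Vset u₁ u₂, ∑ t ∈ T₁ ×ˢ T₂, f t * u1post u₁ ν t t ≤ v.1 ∧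
      ∑ t ∈ T₁ ×ˢ T₂, f t * u2post u₂ ν t t ≤ v.2 := by
  have hf₀ : ∀ t ∈ T₁ ×ˢ T₂, 0 ≤ f t := fun t ht =>
    hf.1 t.1 (mem_product.1 ht).1 t.2 (mem_product.1 ht).2
  have hν₀ : ∀ t ∈ T₁ ×ˢ T₂, (∀ k, 0 ≤ ν t k) ∧ ∑ k, ν t k = 1 := fun t ht =>
    hν t.1 (mem_product.1 ht).1 t.2 (mem_product.1 ht).2
  have hle₀ : ∀ t ∈ T₁ ×ˢ T₂, t.1 ≤ w.1 ∧ t.2 ≤ w.2 := fun t ht =>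
    hle t.1 (mem_product.1 ht).1 t.2 (mem_product.1 ht).2
  refine ⟨_, (convex_Vset u₁ u₂).sum_mem hf₀ (by rw [sum_product]; exact hf.2.1)
    fun t ht => add_disagreement_smul_mem_Vset hw (hν₀ t ht).1 (hν₀ t ht).2, ?_, ?_⟩
  · simp only [Prod.fst_sum, Prod.smul_fst, smul_eq_mul]
    exact sum_le_sum fun t ht => mul_le_mul_of_nonneg_left
      (add_le_add_right (mul_le_mul_of_nonneg_left (hle₀ t ht).1 ((hν₀ t ht).1 0)) _) (hf₀ t ht)
  · simp only [Prod.snd_sum, Prod.smul_snd, smul_eq_mul]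
    exact sum_le_sum fun t ht => mul_le_mul_of_nonneg_left
      (add_le_add_right (mul_le_mul_of_nonneg_left (hle₀ t ht).2 ((hν₀ t ht).1 0)) _) (hf₀ t ht)

/-- **Proposition 1(3).**  If disagreement is commonly known to be strictly Pareto dominated by
some lottery `α₀ a₁ + (1-α₀) a₂`, then there exists a constant (hence incentive compatible),
individually rational and efficient mechanism that is moreover ex-ante incentive efficient. -/
theorem exists_constant_efficient_exAnte_efficient (n : ℕ) (hn : 2 ≤ n)
    (T₁ T₂ : Finset ℝ) (hT₁ : T₁.Nonempty) (hT₂ : T₂.Nonempty)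
    (u₁ u₂ : Fin n → ℝ)
    (hnorm : u₁ ⟨0, by omega⟩ = 1 ∧ u₂ ⟨0, by omega⟩ = 0 ∧
      u₁ ⟨1, by omega⟩ = 0 ∧ u₂ ⟨1, by omega⟩ = 1)
    (f : ℝ × ℝ → ℝ) (hf : IsPrior T₁ T₂ f)
    (hα : ∃ α₀ : ℝ, 0 < α₀ ∧ α₀ < 1 ∧ ∀ t₁ ∈ T₁, ∀ t₂ ∈ T₂, t₁ < α₀ ∧ t₂ < 1 - α₀) :
    ∃ μ : ℝ × ℝ → Fin (n + 1) → ℝ,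
      (∀ t t' : ℝ × ℝ, μ t = μ t') ∧
      Feasible T₁ T₂ μ ∧ IC T₁ T₂ f u₁ u₂ μ ∧ IR T₁ T₂ f u₁ u₂ μ ∧
      (∀ t₁ ∈ T₁, ∀ t₂ ∈ T₂, 0 < f (t₁, t₂) → μ (t₁, t₂) 0 = 0 ∧
        (u1post u₁ μ (t₁, t₂) (t₁, t₂), u2post u₂ μ (t₁, t₂) (t₁, t₂)) ∈ paretoV u₁ u₂) ∧
      ¬ ∃ ν : ℝ × ℝ → Fin (n + 1) → ℝ,
        Feasible T₁ T₂ ν ∧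
        (∑ t₁ ∈ T₁, marg1 T₂ f t₁ * interim1 T₂ f u₁ μ t₁ t₁ ≤
          ∑ t₁ ∈ T₁, marg1 T₂ f t₁ * interim1 T₂ f u₁ ν t₁ t₁) ∧
        (∑ t₂ ∈ T₂, marg2 T₁ f t₂ * interim2 T₁ f u₂ μ t₂ t₂ ≤
          ∑ t₂ ∈ T₂, marg2 T₁ f t₂ * interim2 T₁ f u₂ ν t₂ t₂) ∧
        ((∑ t₁ ∈ T₁, marg1 T₂ f t₁ * interim1 T₂ f u₁ μ t₁ t₁ <
          ∑ t₁ ∈ T₁, marg1 T₂ f t₁ * interim1 T₂ f u₁ ν t₁ t₁) ∨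
         (∑ t₂ ∈ T₂, marg2 T₁ f t₂ * interim2 T₁ f u₂ μ t₂ t₂ <
          ∑ t₂ ∈ T₂, marg2 T₁ f t₂ * interim2 T₁ f u₂ ν t₂ t₂)) := by
  obtain ⟨α, hα₀, hα₁, hlt⟩ := hα
  have hw : (α, 1 - α) ∈ Vset u₁ u₂ :=
    lottery_mem_Vset hnorm.1 hnorm.2.1 hnorm.2.2.1 hnorm.2.2.2 hα₀.le hα₁.le
  obtain ⟨v, hv, hv₁, hv₂⟩ := exists_mem_paretoV_ge hw
  obtain ⟨ℓ, hℓ₀, hℓ₁, hℓ⟩ := hv.1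
  let μ : ℝ × ℝ → Fin (n + 1) → ℝ := fun _ => Fin.cons 0 ℓ
  have hpost₁ : ∀ s t, u1post u₁ μ s t = v.1 := fun s t => by simp [u1post, μ, hℓ]
  have hpost₂ : ∀ s t, u2post u₂ μ s t = v.2 := fun s t => by simp [u2post, μ, hℓ]
  have hint₁ : ∀ t₁ ∈ T₁, ∀ r₁, interim1 T₂ f u₁ μ r₁ t₁ = v.1 := fun t₁ ht₁ r₁ => by
    simp only [interim1, hpost₁]
    rw [← sum_mul, ← sum_div, ← marg1, div_self (hf.2.2.1 t₁ ht₁).ne', one_mul]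
  have hint₂ : ∀ t₂ ∈ T₂, ∀ r₂, interim2 T₁ f u₂ μ r₂ t₂ = v.2 := fun t₂ ht₂ r₂ => by
    simp only [interim2, hpost₂]
    rw [← sum_mul, ← sum_div, ← marg2, div_self (hf.2.2.2 t₂ ht₂).ne', one_mul]
  obtain ⟨s₁, hs₁⟩ := hT₁
  obtain ⟨s₂, hs₂⟩ := hT₂
  refine ⟨μ, fun _ _ => rfl, fun _ _ _ _ => ⟨?_, ?_⟩, ⟨?_, ?_⟩, ⟨?_, ?_⟩, ?_, ?_⟩
  · exact Fin.cases le_rfl hℓ₀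
  · simpa [μ, Fin.sum_univ_succ] using hℓ₁
  · exact fun t₁ ht₁ r₁ _ => by rw [hint₁ t₁ ht₁, hint₁ t₁ ht₁]
  · exact fun t₂ ht₂ r₂ _ => by rw [hint₂ t₂ ht₂, hint₂ t₂ ht₂]
  · exact fun t₁ ht₁ => by
      rw [hint₁ t₁ ht₁]
      exact (hlt t₁ ht₁ s₂ hs₂).1.le.trans hv₁
  · exact fun t₂ ht₂ => by
      rw [hint₂ t₂ ht₂]
      exact (hlt s₁ hs₁ t₂ ht₂).2.le.trans hv₂
  · exact fun _ _ _ _ _ => ⟨rfl, by rwa [hpost₁, hpost₂]⟩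
  · rintro ⟨ν, hν, h₁, h₂, h₃⟩
    have hsum : ∑ t ∈ T₁ ×ˢ T₂, f t = 1 := by rw [sum_product]; exact hf.2.1
    simp only [sum_marg1_mul_interim1 hf.2.2.1, sum_marg2_mul_interim2 hf.2.2.2, hpost₁, hpost₂,
      ← sum_mul, hsum, one_mul] at h₁ h₂ h₃
    obtain ⟨v', hv', h₁', h₂'⟩ := exists_mem_Vset_exAnte_le hf hw
      (fun t₁ ht₁ t₂ ht₂ => ⟨(hlt t₁ ht₁ t₂ ht₂).1.le, (hlt t₁ ht₁ t₂ ht₂).2.le⟩) hν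
    refine hv.2 ⟨v', hv', h₁.trans h₁', h₂.trans h₂', ?_⟩
    rintro rfl
    exact h₃.elim (fun h => (h.trans_le h₁').false) fun h => (h.trans_le h₂').false
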